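/- For every natural number l ≥ 2, the rank-width of the (2l+1) × (2l+1) grid graph is at least l − 1. In particular, the rank-width of square grid graphs is unbounded as the grid size grows. -/

import Mathlib

open scoped BigOperators Classical

noncomputable section

/-- The cut-rank `cutrk_G(A)`: the rank over `GF(2)` of the `A × Aᶜ` adjacency
submatrix of `G`. -/
def cutRank {V : Type} [Fintype V] (G : SimpleGraph V) (A : Set V) : ℕ :=
  Matrix.rank (Matrix.of fun (a : ↥A) (b : ↥Aᶜ) =>
    if G.Adj a.val b.val then (1 : ZMod 2) else 0)

/-- The degree of a vertex: the number of its neighbors. -/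
def deg {M : ℕ} (T : SimpleGraph (Fin M)) (v : Fin M) : ℕ :=
  (T.neighborSet v).ncard

/-- A subcubic tree: a finite tree in which every vertex has degree 1 or 3. -/
def IsSubcubicTree {M : ℕ} (T : SimpleGraph (Fin M)) : Prop :=
  T.IsTree ∧ ∀ v, deg T v = 1 ∨ deg T v = 3

/-- The set of vertices lying in the connected component of the endpoint `w` of
the deleted edge `e` of the tree `T`, transported to `V` along the leaf
labeling `ℓ`. -/
def leafSide {M : ℕ} (T : SimpleGraph (Fin M)) {V : Type}
    (ℓ : {v : Fin M // deg T v = 1} ≃ V) (e : Sym2 (Fin M)) (w : Fin M) : Set V :=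
  {i : V | ∃ l : {v : Fin M // deg T v = 1},
      (T.deleteEdges {e}).Reachable w l.val ∧ ℓ l = i}

/-- The rank-width of `G`: the minimum over all subcubic trees `T` whose leaves
are identified with the vertices of `G` of the maximum over the edges `e` of `T`
of the cut-rank of the induced bipartition. -/
def rankWidth {V : Type} [Fintype V] [DecidableEq V] (G : SimpleGraph V) : ℕ :=
  sInf { r : ℕ | ∃ (M : ℕ) (T : SimpleGraph (Fin M)), IsSubcubicTree T ∧
    ∃ ℓ : {v : Fin M // deg T v = 1} ≃ V,
      r = sSup { s : ℕ | ∃ e ∈ T.edgeSet, ∃ w, w ∈ e ∧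
        s = cutRank G (leafSide T ℓ e w) } }

/-- The `d × d` grid graph on `Fin d × Fin d`: two vertices are adjacent iff they
agree in one coordinate and differ by exactly `1` in the other. -/
def gridGraph (d : ℕ) : SimpleGraph (Fin d × Fin d) :=
  SimpleGraph.fromRel fun a b =>
    (a.1 = b.1 ∧ a.2.val + 1 = b.2.val) ∨ (a.2 = b.2 ∧ a.1.val + 1 = b.1.val)

/-- Triangular adjacency between two families of vertices on opposite sides of a cut bounds the
cut-rank from below. -/
theorem card_le_cutRank {V ι : Type} [Fintype V] [Fintype ι] (G : SimpleGraph V) (A : Set V)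
    (a b : ι → V) (f : ι → ℕ) (ha : ∀ i, a i ∈ A) (hb : ∀ i, b i ∉ A)
    (hadj : ∀ i, G.Adj (a i) (b i)) (htri : ∀ i j, i ≠ j → G.Adj (a i) (b j) → f i < f j) :
    Fintype.card ι ≤ cutRank G A := by
  set N : Matrix A ↥Aᶜ (ZMod 2) := Matrix.of fun x y =>
    if G.Adj x.val y.val then (1 : ZMod 2) else 0 with hN
  have hli : LinearIndependent (ZMod 2)
      (N.submatrix (fun i => (⟨a i, ha i⟩ : A)) (fun i => (⟨b i, hb i⟩ : ↥Aᶜ))).row := by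
    rw [Fintype.linearIndependent_iff]
    intro c hc
    have key : ∀ n i, f i = n → c i = 0 := by
      intro n
      induction n using Nat.strong_induction_on with
      | _ n ih =>
        intro j hj
        have h := congrFun hc j
        rw [Finset.sum_apply, Finset.sum_eq_single j] at h
        · simpa [hN, hadj j] using h
        · intro i _ hij
          by_cases hG : G.Adj (a i) (b j)
          · simp [ih (f i) (hj ▸ htri i j hij hG) i rfl]
          · simp [hN, hG]
        · simp
    exact fun i => key _ i rfl
  rw [← hli.rank_matrix]
  exact Matrix.rank_submatrix_le _ _ _

theorem cutRank_compl_le {V : Type} [Fintype V] (G : SimpleGraph V) (A : Set V) :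
    cutRank G Aᶜ ≤ cutRank G A := by
  unfold cutRank
  rw [← Matrix.rank_transpose (Matrix.of fun (a : ↥A) (b : ↥Aᶜ) =>
    if G.Adj a.val b.val then (1 : ZMod 2) else 0)]
  convert Matrix.rank_submatrix_le _ id (fun x : ↥Aᶜᶜ => (⟨x.1, not_not.1 x.2⟩ : A)) using 2
  · ext x y
    simp [G.adj_comm]
  · infer_instance

theorem cutRank_compl {V : Type} [Fintype V] (G : SimpleGraph V) (A : Set V) :
    cutRank G Aᶜ = cutRank G A :=
  (cutRank_compl_le G A).antisymm (by simpa using cutRank_compl_le G Aᶜ)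

theorem cutRank_preimage {V : Type} [Fintype V] {G : SimpleGraph V} (φ : G ≃g G) (A : Set V) :
    cutRank G (φ ⁻¹' A) = cutRank G A := by
  unfold cutRank
  rw [← Matrix.rank_submatrix (Matrix.of fun (a : ↥A) (b : ↥Aᶜ) =>
    if G.Adj a.val b.val then (1 : ZMod 2) else 0)
    (φ.toEquiv.subtypeEquiv (p := (· ∈ φ ⁻¹' A)) (q := (· ∈ A)) fun _ => Iff.rfl)
    (φ.toEquiv.subtypeEquiv (p := (· ∈ (φ ⁻¹' A)ᶜ)) (q := (· ∈ Aᶜ)) fun _ => Iff.rfl)]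
  congr 1
  ext x y
  simp [φ.map_adj_iff]

/-- The reflection of the grid in its diagonal. -/
def gridSwap (d : ℕ) : gridGraph d ≃g gridGraph d where
  toEquiv := Equiv.prodComm _ _
  map_rel_iff' := by
    rintro ⟨a, b⟩ ⟨c, e⟩
    simp [gridGraph]
    tauto

theorem gridGraph_adj {d : ℕ} {i j i' j' : Fin d} :
    (gridGraph d).Adj (i, j) (i', j') ↔
      (i = i' ∧ (j.val + 1 = j'.val ∨ j'.val + 1 = j.val)) ∨
      (j = j' ∧ (i.val + 1 = i'.val ∨ i'.val + 1 = i.val)) := by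
  simp only [gridGraph, SimpleGraph.fromRel_adj, ne_eq, Prod.mk.injEq, Fin.ext_iff]
  omega

/-- Walking along a row from a vertex of `A` to a closest vertex outside `A` crosses the cut in
the last step. -/
theorem exists_closest_crossing {d : ℕ} (A : Set (Fin d × Fin d)) (i p : Fin d)
    (hp : (i, p) ∈ A) (hB : ∃ q, (i, q) ∉ A) :
    ∃ x y : Fin d, (i, x) ∈ A ∧ (i, y) ∉ A ∧ (x.val + 1 = y.val ∨ y.val + 1 = x.val) ∧
      ((x : ℤ) - p).natAbs + 1 = ((y : ℤ) - p).natAbs := by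
  obtain ⟨y, hy, hmin⟩ := Set.exists_min_image {q | (i, q) ∉ A}
    (fun q => ((q : ℤ) - p).natAbs) (Set.toFinite _) hB
  have hne : y.val ≠ p.val := fun h => hy (Fin.ext h ▸ hp)
  obtain ⟨x, hx⟩ : ∃ x : Fin d, (x.val + 1 = y.val ∨ y.val + 1 = x.val) ∧
      ((x : ℤ) - p).natAbs + 1 = ((y : ℤ) - p).natAbs := by
    rcases lt_or_gt_of_ne hne with h | h
    · exact ⟨⟨y + 1, by omega⟩, by simp, by simp; omega⟩
    · exact ⟨⟨y - 1, by omega⟩, by simp; omega, by simp; omega⟩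
  refine ⟨x, y, ?_, hy, hx⟩
  by_contra hxA
  have := hmin x hxA
  omega

/-- If every row meets both sides of the cut, the rows of even index give an identity submatrix. -/
theorem lt_cutRank_of_rows_mixed {l : ℕ} (A : Set (Fin (2 * l + 1) × Fin (2 * l + 1)))
    (h : ∀ i, (∃ p, (i, p) ∈ A) ∧ ∃ q, (i, q) ∉ A) :
    l + 1 ≤ cutRank (gridGraph (2 * l + 1)) A := by
  have hc : ∀ i, ∃ x y : Fin (2 * l + 1), (i, x) ∈ A ∧ (i, y) ∉ A ∧
      (x.val + 1 = y.val ∨ y.val + 1 = x.val) := by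
    intro i
    obtain ⟨⟨p, hp⟩, hq⟩ := h i
    obtain ⟨x, y, hx, hy, hxy, -⟩ := exists_closest_crossing A i p hp hq
    exact ⟨x, y, hx, hy, hxy⟩
  choose x y hx hy hxy using hc
  let e : Fin (l + 1) → Fin (2 * l + 1) := fun i => ⟨2 * i, by omega⟩
  have := card_le_cutRank (gridGraph (2 * l + 1)) A (fun i => (e i, x (e i)))
    (fun i => (e i, y (e i))) (fun _ => 0) (fun i => hx _) (fun i => hy _)
    (fun i => gridGraph_adj.2 (Or.inl ⟨rfl, hxy _⟩)) (fun i j hij hG => by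
      have hij' : i.val ≠ j.val := fun h => hij (Fin.ext h)
      rw [gridGraph_adj] at hG
      simp only [e, Fin.ext_iff] at hG
      omega)
  simpa using this

/-- If a column lies in `A`, the cut-rank is at least the number of rows that leave `A`. -/
theorem ncard_rows_le_cutRank {d : ℕ} (A : Set (Fin d × Fin d)) (p : Fin d)
    (hp : ∀ i, (i, p) ∈ A) : {i | ∃ q, (i, q) ∉ A}.ncard ≤ cutRank (gridGraph d) A := by
  have hc : ∀ i : {i | ∃ q, (i, q) ∉ A}, ∃ x y : Fin d, (i.1, x) ∈ A ∧ (i.1, y) ∉ A ∧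
      (x.val + 1 = y.val ∨ y.val + 1 = x.val) ∧
      ((x : ℤ) - p).natAbs + 1 = ((y : ℤ) - p).natAbs :=
    fun i => exists_closest_crossing A i.1 p (hp _) i.2
  choose x y hx hy hxy hd using hc
  rw [← Nat.card_coe_set_eq, Nat.card_eq_fintype_card]
  refine card_le_cutRank (gridGraph d) A (fun i => (i.1, x i)) (fun i => (i.1, y i))
    (fun i => d - ((x i : ℤ) - p).natAbs) hx hy
    (fun i => gridGraph_adj.2 (Or.inl ⟨rfl, hxy i⟩)) ?_
  intro i j hij hG
  have hij' : i.1 ≠ j.1 := fun h => hij (Subtype.ext h)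
  rw [gridGraph_adj] at hG
  obtain ⟨h, -⟩ | ⟨h, -⟩ := hG
  · exact absurd h hij'
  · have h1 := hd j
    rw [← h] at h1
    have := (x i).2
    have := p.2
    omega

/-- If a row and a column lie in `A`, then the complement of `A` has at most `cutRank ^ 2` elements. -/
theorem ncard_compl_le_sq_cutRank {d : ℕ} (A : Set (Fin d × Fin d)) (p q : Fin d)
    (hp : ∀ i, (i, p) ∈ A) (hq : ∀ j, (q, j) ∈ A) :
    Aᶜ.ncard ≤ cutRank (gridGraph d) A ^ 2 := by
  have hr := ncard_rows_le_cutRank A p hp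
  have hc := ncard_rows_le_cutRank (gridSwap d ⁻¹' A) q hq
  rw [cutRank_preimage] at hc
  have hsub : Aᶜ ⊆ {i | ∃ j, (i, j) ∉ A} ×ˢ {j | ∃ i, (j, i) ∉ gridSwap d ⁻¹' A} :=
    fun v hv => ⟨⟨v.2, hv⟩, ⟨v.1, hv⟩⟩
  calc Aᶜ.ncard ≤ _ := Set.ncard_le_ncard hsub (Set.toFinite _)
    _ = _ := Set.ncard_prod
    _ ≤ _ := by rw [sq]; exact Nat.mul_le_mul hr hc

/-- A cut of small rank in the grid has a small side. -/
theorem ncard_le_sq_cutRank_or {l : ℕ} (A : Set (Fin (2 * l + 1) × Fin (2 * l + 1)))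
    (h : cutRank (gridGraph (2 * l + 1)) A ≤ l) :
    A.ncard ≤ cutRank (gridGraph (2 * l + 1)) A ^ 2 ∨
      Aᶜ.ncard ≤ cutRank (gridGraph (2 * l + 1)) A ^ 2 := by
  obtain ⟨q, hq⟩ : ∃ q, (∀ j, (q, j) ∉ A) ∨ ∀ j, (q, j) ∈ A := by
    by_contra! hcon
    have := lt_cutRank_of_rows_mixed A hcon
    omega
  obtain ⟨p, hp⟩ : ∃ p, (∀ i, (i, p) ∉ A) ∨ ∀ i, (i, p) ∈ A := by
    by_contra! hcon
    have := lt_cutRank_of_rows_mixed (gridSwap _ ⁻¹' A) hcon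
    rw [cutRank_preimage] at this
    omega
  rcases hp with hp | hp <;> rcases hq with hq | hq
  · left
    have := ncard_compl_le_sq_cutRank Aᶜ p q hp hq
    rwa [compl_compl, cutRank_compl] at this
  · exact absurd (hq p) (hp q)
  · exact absurd (hp q) (hq p)
  · exact Or.inr (ncard_compl_le_sq_cutRank A p q hp hq)

/-- The vertices on the side of `v` after deletion of the edge `uv`. -/
def treeSide {W : Type} (T : SimpleGraph W) (u v : W) : Set W :=
  {x | (T.deleteEdges {s(u, v)}).Reachable v x}

section TreeSide

variable {W : Type} {T : SimpleGraph W} {u v a x : W}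

theorem mem_treeSide_self : v ∈ treeSide T u v := SimpleGraph.Reachable.refl v

theorem notMem_treeSide (hT : T.IsTree) (h : T.Adj u v) : u ∉ treeSide T u v := fun hx =>
  SimpleGraph.isAcyclic_iff_forall_adj_isBridge.1 hT.isAcyclic h hx.symm

theorem mem_treeSide_or (hT : T.IsTree) (x : W) : x ∈ treeSide T u v ∨ x ∈ treeSide T v u := by
  obtain ⟨p⟩ := hT.connected.preconnected x v
  induction p with
  | nil => exact Or.inl mem_treeSide_self
  | @cons x y w h p ih =>
    by_cases he : s(x, y) = s(u, w)
    · rcases Sym2.eq_iff.1 he with ⟨rfl, -⟩ | ⟨rfl, -⟩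
      · exact Or.inr mem_treeSide_self
      · exact Or.inl mem_treeSide_self
    · have hxy : (T.deleteEdges {s(u, w)}).Adj y x := by
        simpa [SimpleGraph.deleteEdges_adj, T.adj_comm y x, h, Sym2.eq_swap (a := y)] using he
      refine ih.imp (fun hy => hy.trans hxy.reachable) (fun hy => ?_)
      rw [treeSide, Sym2.eq_swap] at hy ⊢
      exact hy.trans hxy.reachable

theorem treeSide_compl (hT : T.IsTree) (h : T.Adj u v) : (treeSide T u v)ᶜ = treeSide T v u := by
  ext x
  refine ⟨fun hx => (mem_treeSide_or hT x).resolve_left hx, fun hx hx' => ?_⟩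
  rw [treeSide, Sym2.eq_swap] at hx
  exact SimpleGraph.isAcyclic_iff_forall_adj_isBridge.1 hT.isAcyclic h
    (SimpleGraph.Reachable.trans hx hx'.symm)

theorem treeSide_subset (hT : T.IsTree) (hu : T.Adj u v) (ha : T.Adj v a) (hua : a ≠ u) :
    treeSide T v a ⊆ treeSide T u v := by
  intro x hx
  by_contra hxv
  obtain ⟨q⟩ : x ∈ treeSide T v u := (mem_treeSide_or hT x).resolve_left hxv
  have hq : v ∉ q.support := fun h => notMem_treeSide hT hu.symm ⟨q.takeUntil v h⟩
  have hux : (T.deleteEdges {s(v, a)}).Reachable u x := by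
    refine ⟨(q.mapLe (T.deleteEdges_le _)).toDeleteEdges _ ?_⟩
    rintro e he rfl
    rw [SimpleGraph.Walk.edges_mapLe_eq_edges] at he
    exact hq (q.fst_mem_support_of_mem_edges he)
  have hvu : (T.deleteEdges {s(v, a)}).Adj v u := by
    rw [SimpleGraph.deleteEdges_adj]
    exact ⟨hu.symm, fun h => hua (Sym2.congr_right.1 h).symm⟩
  exact notMem_treeSide hT ha ((hvu.reachable.trans hux).trans hx.symm).symm

theorem exists_mem_treeSide (hx : x ∈ treeSide T u v) (hxv : x ≠ v) :
    ∃ a, T.Adj v a ∧ a ≠ u ∧ x ∈ treeSide T v a := by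
  obtain ⟨p, hp⟩ := SimpleGraph.Reachable.exists_isPath hx
  cases p with
  | nil => exact absurd rfl hxv
  | @cons _ a _ h p =>
    rw [SimpleGraph.Walk.cons_isPath_iff] at hp
    rw [SimpleGraph.deleteEdges_adj] at h
    refine ⟨a, h.1, ?_, ?_⟩
    · rintro rfl
      exact h.2 Sym2.eq_swap
    · refine ⟨(p.mapLe (T.deleteEdges_le _)).toDeleteEdges _ ?_⟩
      rintro e he rfl
      rw [SimpleGraph.Walk.edges_mapLe_eq_edges] at he
      exact hp.2 (p.fst_mem_support_of_mem_edges he)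

end TreeSide

/-- A subcubic tree with at least `3 * k` leaves has an edge with at least `k` leaves on either
side. -/
theorem exists_balanced_edge {M : ℕ} {T : SimpleGraph (Fin M)} (hT : IsSubcubicTree T)
    {k : ℕ} (hk : 1 ≤ k) (hN : 3 * k ≤ {x | deg T x = 1}.ncard) :
    ∃ u v, T.Adj u v ∧ k ≤ (treeSide T u v ∩ {x | deg T x = 1}).ncard ∧
      k ≤ ((treeSide T u v)ᶜ ∩ {x | deg T x = 1}).ncard := by
  set L : Set (Fin M) := {x | deg T x = 1}
  by_contra! hcon
  have hsum : ∀ S : Set (Fin M), (S ∩ L).ncard + (Sᶜ ∩ L).ncard = L.ncard := fun S => by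
    rw [Set.inter_comm, Set.inter_comm Sᶜ, ← Set.sdiff_eq]
    exact Set.ncard_inter_add_ncard_sdiff_eq_ncard L S
  have hflip : ∀ u v, T.Adj u v → ¬ k ≤ ((treeSide T u v)ᶜ ∩ L).ncard ∨
      ¬ k ≤ ((treeSide T v u)ᶜ ∩ L).ncard := by
    intro u v h
    rw [← treeSide_compl hT.1 h, compl_compl]
    by_contra! hc
    exact absurd (hcon u v h hc.2) (not_lt.2 hc.1)
  have hmin : ∃ e : Fin M × Fin M, T.Adj e.1 e.2 ∧ ¬ k ≤ ((treeSide T e.1 e.2)ᶜ ∩ L).ncard := by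
    obtain ⟨v, hv⟩ : L.Nonempty := by
      rw [Set.nonempty_iff_ne_empty]
      rintro h
      simp [h] at hN
      omega
    obtain ⟨u, hu⟩ : (T.neighborSet v).Nonempty := by
      rw [Set.nonempty_iff_ne_empty]
      intro h
      simp [L, deg, h] at hv
    exact (hflip v u hu).elim (fun h => ⟨(v, u), hu, h⟩) (fun h => ⟨(u, v), hu.symm, h⟩)
  obtain ⟨⟨u, v⟩, ⟨huv, hbig⟩, hle⟩ := Set.exists_min_image
    {e : Fin M × Fin M | T.Adj e.1 e.2 ∧ ¬ k ≤ ((treeSide T e.1 e.2)ᶜ ∩ L).ncard}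
    (fun e => (treeSide T e.1 e.2).ncard) (Set.toFinite _) hmin
  dsimp only at huv hbig hle
  have hsmall : ∀ a, T.Adj v a → a ≠ u → (treeSide T v a ∩ L).ncard < k := by
    intro a ha hau
    by_contra! hc
    have hb : ¬ k ≤ ((treeSide T v a)ᶜ ∩ L).ncard := not_le.2 (hcon v a ha hc)
    refine absurd (hle (v, a) ⟨ha, hb⟩) (not_le.2 (Set.ncard_lt_ncard ?_ (Set.toFinite _)))
    exact (treeSide_subset hT.1 huv ha hau).ssubset_of_mem_notMem mem_treeSide_self
      (notMem_treeSide hT.1 ha)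
  have hS := hsum (treeSide T u v)
  have hcover : treeSide T u v ∩ L ⊆
      ({v} ∩ L) ∪ ⋃ a ∈ T.neighborSet v \ {u}, (treeSide T v a ∩ L) := by
    rintro x ⟨hx, hxL⟩
    by_cases hxv : x = v
    · exact Or.inl ⟨hxv, hxL⟩
    · obtain ⟨a, ha, hau, hxa⟩ := exists_mem_treeSide hx hxv
      exact Or.inr (Set.mem_biUnion (show a ∈ T.neighborSet v \ {u} from ⟨ha, hau⟩) ⟨hxa, hxL⟩)
  have hdiff := Set.ncard_sdiff_singleton_of_mem (show u ∈ T.neighborSet v from huv.symm)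
  have hle' := Set.ncard_le_ncard hcover (Set.toFinite _)
  rcases hT.2 v with hd | hd
  · rw [← deg, hd, Nat.sub_self, Set.ncard_eq_zero] at hdiff
    rw [hdiff] at hle'
    have : ({v} ∩ L).ncard ≤ 1 :=
      (Set.ncard_le_ncard Set.inter_subset_left).trans_eq (Set.ncard_singleton v)
    simp only [Set.mem_empty_iff_false, Set.iUnion_of_empty, Set.iUnion_empty,
      Set.union_empty] at hle'
    omega
  · rw [← deg, hd] at hdiff
    obtain ⟨a, b, -, hab⟩ := Set.ncard_eq_two.1 hdiff
    have hv : {v} ∩ L = ∅ := by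
      ext x
      simp only [Set.mem_inter_iff, Set.mem_singleton_iff, Set.mem_ofPred_eq, L,
        Set.mem_empty_iff_false, iff_false, not_and]
      rintro rfl h
      omega
    have ha : a ∈ T.neighborSet v \ {u} := hab ▸ Or.inl rfl
    have hb : b ∈ T.neighborSet v \ {u} := hab ▸ Or.inr rfl
    rw [hab, hv, Set.biUnion_pair, Set.empty_union] at hle'
    have := Set.ncard_union_le (treeSide T v a ∩ L) (treeSide T v b ∩ L)
    have := hsmall a ha.1 ha.2
    have := hsmall b hb.1 hb.2
    omega

theorem ncard_leafSide {M : ℕ} (T : SimpleGraph (Fin M)) {V : Type}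
    (ℓ : {v : Fin M // deg T v = 1} ≃ V) (e : Sym2 (Fin M)) (w : Fin M) :
    (leafSide T ℓ e w).ncard =
      ({x | (T.deleteEdges {e}).Reachable w x} ∩ {x | deg T x = 1}).ncard := by
  have h : leafSide T ℓ e w =
      ℓ '' (Subtype.val ⁻¹' {x | (T.deleteEdges {e}).Reachable w x}) := rfl
  rw [h, Set.ncard_image_of_injective _ ℓ.injective,
    ← Set.ncard_image_of_injective _ Subtype.val_injective]
  congr 1
  ext x
  simp [and_comm]

theorem compl_leafSide {M : ℕ} {T : SimpleGraph (Fin M)} (hT : T.IsTree) {V : Type}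
    (ℓ : {v : Fin M // deg T v = 1} ≃ V) {u v : Fin M} (h : T.Adj u v) :
    (leafSide T ℓ s(u, v) v)ᶜ = leafSide T ℓ s(v, u) u := by
  have h' : ∀ u v, leafSide T ℓ s(u, v) v = ℓ '' (Subtype.val ⁻¹' treeSide T u v) :=
    fun _ _ => rfl
  rw [h', h', ← treeSide_compl hT h, Set.preimage_compl, Set.image_compl_eq ℓ.bijective]

theorem bddAbove_leafSide_cutRank {M : ℕ} (T : SimpleGraph (Fin M)) {V : Type} [Fintype V]
    (G : SimpleGraph V) (ℓ : {v : Fin M // deg T v = 1} ≃ V) :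
    BddAbove {s : ℕ | ∃ e ∈ T.edgeSet, ∃ w, w ∈ e ∧ s = cutRank G (leafSide T ℓ e w)} := by
  refine ((Set.finite_range fun p : Sym2 (Fin M) × Fin M =>
    cutRank G (leafSide T ℓ p.1 p.2)).subset ?_).bddAbove
  rintro _ ⟨e, -, w, -, rfl⟩
  exact ⟨(e, w), rfl⟩

theorem le_sSup_cutRank_grid {M l : ℕ} (hl : 2 ≤ l) {T : SimpleGraph (Fin M)}
    (hT : IsSubcubicTree T)
    (ℓ : {v : Fin M // deg T v = 1} ≃ Fin (2 * l + 1) × Fin (2 * l + 1)) :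
    l - 1 ≤ sSup {s : ℕ | ∃ e ∈ T.edgeSet, ∃ w, w ∈ e ∧
      s = cutRank (gridGraph (2 * l + 1)) (leafSide T ℓ e w)} := by
  obtain ⟨m, rfl⟩ := Nat.exists_eq_add_of_le hl
  have hcard : {x | deg T x = 1}.ncard = (2 * (2 + m) + 1) * (2 * (2 + m) + 1) := by
    rw [← Nat.card_coe_set_eq]
    exact (Nat.card_congr ℓ).trans (by simp)
  obtain ⟨u, v, huv, h1, h2⟩ := exists_balanced_edge hT (k := m ^ 2 + 1) (by omega)
    (by rw [hcard]; nlinarith)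
  have h1' : m ^ 2 + 1 ≤ (leafSide T ℓ s(u, v) v).ncard := by rwa [ncard_leafSide]
  have h2' : m ^ 2 + 1 ≤ (leafSide T ℓ s(u, v) v)ᶜ.ncard := by
    rw [treeSide_compl hT.1 huv] at h2
    rwa [compl_leafSide hT.1 ℓ huv, ncard_leafSide]
  refine le_csSup_of_le (bddAbove_leafSide_cutRank T _ ℓ)
    ⟨s(u, v), huv, v, Sym2.mem_mk_right u v, rfl⟩ ?_
  by_contra! hlt
  have hle : cutRank (gridGraph (2 * (2 + m) + 1)) (leafSide T ℓ s(u, v) v) ≤ m := by omega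
  have := Nat.pow_le_pow_left hle 2
  rcases ncard_le_sq_cutRank_or _ (hle.trans (by omega)) with h | h <;> omega

/-- The caterpillar on `2 * m` vertices: `2 * j` and `2 * j + 1` hang from `2 * j - 1`, and `1`
hangs from `0`. -/
def caterpillar (m : ℕ) : SimpleGraph (Fin (2 * m)) where
  Adj a b := (0 < b.val ∧ a.val = 2 * (b.val / 2) - 1) ∨ (0 < a.val ∧ b.val = 2 * (a.val / 2) - 1)
  symm := ⟨fun _ _ h => h.symm⟩
  loopless := ⟨fun _ h => by omega⟩

theorem caterpillar_isTree {m : ℕ} (hm : 0 < m) : (caterpillar m).IsTree := by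
  have hconn : (caterpillar m).Connected := by
    have h0 : ∀ n (h : n < 2 * m), (caterpillar m).Reachable ⟨0, by omega⟩ ⟨n, h⟩ := by
      intro n
      induction n using Nat.strong_induction_on with
      | _ n ih =>
        intro h
        rcases Nat.eq_zero_or_pos n with rfl | hn
        · rfl
        · refine (ih (2 * (n / 2) - 1) (by omega) (by omega)).trans
            (SimpleGraph.Adj.reachable (Or.inl ⟨hn, rfl⟩))
    have : Nonempty (Fin (2 * m)) := ⟨⟨0, by omega⟩⟩
    exact ⟨fun a b => (h0 a a.2).symm.trans (h0 b b.2)⟩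
  refine SimpleGraph.isTree_iff_connected_and_card.2
    ⟨hconn, le_antisymm ?_ hconn.card_vert_le_card_edgeSet_add_one⟩
  let f : Fin (2 * m - 1) → Sym2 (Fin (2 * m)) := fun i =>
    s(⟨2 * ((i + 1) / 2) - 1, by omega⟩, ⟨i + 1, by omega⟩)
  have hsub : (caterpillar m).edgeSet ⊆ Set.range f := by
    intro e
    induction e with
    | _ a b =>
      rintro (⟨h, h'⟩ | ⟨h, h'⟩) <;> dsimp only at h h'
      · refine ⟨⟨b - 1, by omega⟩, Sym2.eq_iff.2 (Or.inl ⟨Fin.ext ?_, Fin.ext ?_⟩)⟩ <;>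
          dsimp only <;> omega
      · refine ⟨⟨a - 1, by omega⟩, Sym2.eq_iff.2 (Or.inr ⟨Fin.ext ?_, Fin.ext ?_⟩)⟩ <;>
          dsimp only <;> omega
  have h1 := Set.ncard_le_ncard hsub (Set.toFinite _)
  have h2 : (Set.range f).ncard ≤ 2 * m - 1 := by
    rw [← Set.image_univ]
    exact (Set.ncard_image_le Set.finite_univ).trans (by simp [Set.ncard_univ])
  rw [Nat.card_coe_set_eq, Nat.card_fin]
  omega

theorem deg_caterpillar {m : ℕ} (v : Fin (2 * m)) :
    deg (caterpillar m) v = if v.val % 2 = 0 ∨ v.val + 1 = 2 * m then 1 else 3 := by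
  unfold deg
  split_ifs with h
  · rw [Set.ncard_eq_one]
    refine ⟨⟨if v.val = 0 then 1 else 2 * (v.val / 2) - 1, by split_ifs <;> omega⟩, ?_⟩
    ext x
    simp only [SimpleGraph.mem_neighborSet, caterpillar, Set.mem_singleton_iff, Fin.ext_iff]
    split_ifs <;> omega
  · rw [Set.ncard_eq_three]
    refine ⟨⟨2 * (v.val / 2) - 1, by omega⟩, ⟨v + 1, by omega⟩, ⟨v + 2, by omega⟩, ?_, ?_, ?_, ?_⟩
    · simp only [ne_eq, Fin.ext_iff]; omega
    · simp only [ne_eq, Fin.ext_iff]; omega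
    · simp only [ne_eq, Fin.ext_iff]; omega
    · ext x
      simp only [SimpleGraph.mem_neighborSet, caterpillar, Set.mem_singleton_iff,
        Set.mem_insert_iff, Fin.ext_iff]
      omega

theorem caterpillar_leaf_iff {m : ℕ} (v : Fin (2 * m)) :
    deg (caterpillar m) v = 1 ↔ v.val % 2 = 0 ∨ v.val + 1 = 2 * m := by
  rw [deg_caterpillar]
  split_ifs with h <;> simp [h]

theorem card_leaves_caterpillar {m : ℕ} (hm : 0 < m) :
    Nat.card {v : Fin (2 * m) // deg (caterpillar m) v = 1} = m + 1 := by
  let f : Fin (m + 1) → {v : Fin (2 * m) // deg (caterpillar m) v = 1} := fun i =>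
    ⟨⟨if i.val < m then 2 * i else 2 * m - 1, by split_ifs <;> omega⟩, by
      rw [caterpillar_leaf_iff]
      dsimp only
      split_ifs <;> omega⟩
  have hf : f.Bijective := by
    constructor
    · intro i j hij
      simp only [f, Subtype.mk.injEq, Fin.mk.injEq] at hij
      apply Fin.ext
      split_ifs at hij <;> omega
    · rintro ⟨v, hv⟩
      have hv' := (caterpillar_leaf_iff v).1 hv
      refine ⟨⟨if v.val + 1 = 2 * m then m else v / 2, by split_ifs <;> omega⟩, ?_⟩
      simp only [f, Subtype.mk.injEq, Fin.ext_iff]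
      split_ifs <;> omega
  rw [← Nat.card_congr (Equiv.ofBijective f hf), Nat.card_fin]

/-- Every vertex set with at least two elements is the leaf set of some subcubic tree. -/
theorem exists_subcubicTree {V : Type} [Fintype V] (hV : 2 ≤ Fintype.card V) :
    ∃ (M : ℕ) (T : SimpleGraph (Fin M)), IsSubcubicTree T ∧
      Nonempty ({v : Fin M // deg T v = 1} ≃ V) := by
  refine ⟨2 * (Fintype.card V - 1), caterpillar _, ⟨caterpillar_isTree (by omega), fun v => ?_⟩, ?_⟩
  · rw [deg_caterpillar]
    split_ifs <;> simp
  · rw [← Finite.card_eq, card_leaves_caterpillar (by omega), Nat.card_eq_fintype_card]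
    omega

theorem le_rankWidth_grid {l : ℕ} (hl : 2 ≤ l) : l - 1 ≤ rankWidth (gridGraph (2 * l + 1)) := by
  refine le_csInf ?_ ?_
  · obtain ⟨M, T, hT, ⟨ℓ⟩⟩ := exists_subcubicTree (V := Fin (2 * l + 1) × Fin (2 * l + 1))
      (by simp only [Fintype.card_prod, Fintype.card_fin]; nlinarith)
    exact ⟨_, M, T, hT, ℓ, rfl⟩
  · rintro _ ⟨M, T, hT, ℓ, rfl⟩
    exact le_sSup_cutRank_grid hl hT ℓ

/-- For every `l ≥ 2`, the rank-width of the `(2l+1) × (2l+1)` grid graph is at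
least `l − 1`.  In particular, the rank-width of square grid graphs is unbounded
as the grid size grows. -/
theorem rankWidth_grid_lower_bound :
    (∀ l : ℕ, 2 ≤ l → l - 1 ≤ rankWidth (gridGraph (2 * l + 1))) ∧
    (∀ c : ℕ, ∃ d : ℕ, c < rankWidth (gridGraph d)) := by
  refine ⟨fun l hl => le_rankWidth_grid hl, fun c => ⟨2 * (c + 2) + 1, ?_⟩⟩
  have := le_rankWidth_grid (l := c + 2) (by omega)
  omega
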